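/- Complete development bounds parallel reduction: for φ-terms t, t', if t ⇛ t' then t' ⇛ t⁺. -/

import Mathlib

namespace PhiCalc

/-- φ-terms over a set of attribute labels `L`. An object term carries a finite
list of attributes: `(a, none)` is a void attribute, `(b, some t)` is an
attached attribute. -/
inductive Tm (L : Type) : Type where
  | loc : Nat → Tm L
  | dot : Tm L → L → Tm L
  | app : Tm L → L → Tm L → Tm L
  | obj : List (L × Option (Tm L)) → Tm L

namespace Tm

variable {L : Type}

/-- Look up a label among the attributes of an object:
`none` = the label is missing, `some none` = void attribute,
`some (some t)` = attribute attached to `t`. -/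
def lookupAttr [DecidableEq L] (a : L) : List (L × Option (Tm L)) → Option (Option (Tm L))
  | [] => none
  | (b, o) :: rest => if a = b then some o else lookupAttr a rest

/-- Attach term `u` to the (first occurrence of) label `a`. -/
def attachAttr [DecidableEq L] (a : L) (u : Tm L) :
    List (L × Option (Tm L)) → List (L × Option (Tm L))
  | [] => []
  | (b, o) :: rest => if a = b then (b, some u) :: rest else (b, o) :: attachAttr a u rest

mutual
/-- Locator increment `↑ₙ t`. -/
def incAt : Nat → Tm L → Tm L
  | n, loc m => if m < n then loc m else loc (m + 1)
  | n, dot t a => dot (incAt n t) a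
  | n, app t a u => app (incAt n t) a (incAt n u)
  | n, obj attrs => obj (incAtList (n + 1) attrs)

def incAtList : Nat → List (L × Option (Tm L)) → List (L × Option (Tm L))
  | _, [] => []
  | n, (a, none) :: rest => (a, none) :: incAtList n rest
  | n, (a, some t) :: rest => (a, some (incAt n t)) :: incAtList n rest
end

mutual
/-- Locator substitution `t[ρ^n ↦ u]`. -/
def subst : Tm L → Nat → Tm L → Tm L
  | loc m, n, u => if m < n then loc m else if m = n then u else loc (m - 1)
  | dot t a, n, u => dot (subst t n u) a
  | app t a v, n, u => app (subst t n u) a (subst v n u)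
  | obj attrs, n, u => obj (substList attrs (n + 1) (incAt 0 u))

def substList : List (L × Option (Tm L)) → Nat → Tm L → List (L × Option (Tm L))
  | [], _, _ => []
  | (a, none) :: rest, n, u => (a, none) :: substList rest n u
  | (a, some t) :: rest, n, u => (a, some (subst t n u)) :: substList rest n u
end

section Reductions

variable [DecidableEq L]

/-- One-step (regular) reduction `⇝`, parametrized by the decorator label `phi`. -/
inductive Step (phi : L) : Tm L → Tm L → Prop where
  | congObj {t t' : Tm L} (pre post : List (L × Option (Tm L))) (b : L) :
      Step phi t t' →
      Step phi (obj (pre ++ (b, some t) :: post)) (obj (pre ++ (b, some t') :: post))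
  | congDot {t t' : Tm L} (a : L) : Step phi t t' → Step phi (dot t a) (dot t' a)
  | congAppL {t t' u : Tm L} (a : L) : Step phi t t' → Step phi (app t a u) (app t' a u)
  | congAppR {t u u' : Tm L} (a : L) : Step phi u u' → Step phi (app t a u) (app t a u')
  | dotStep {attrs : List (L × Option (Tm L))} {c : L} {tc : Tm L} :
      lookupAttr c attrs = some (some tc) →
      Step phi (dot (obj attrs) c) (subst tc 0 (obj attrs))
  | dotPhi {attrs : List (L × Option (Tm L))} {c : L} :
      lookupAttr c attrs = none → (lookupAttr phi attrs).isSome →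
      Step phi (dot (obj attrs) c) (dot (dot (obj attrs) phi) c)
  | appStep {attrs : List (L × Option (Tm L))} {c : L} {u : Tm L} :
      lookupAttr c attrs = some none →
      Step phi (app (obj attrs) c u) (obj (attachAttr c (incAt 0 u) attrs))

mutual
/-- Parallel reduction `⇛`. -/
inductive Par (phi : L) : Tm L → Tm L → Prop where
  | loc (n : Nat) : Par phi (Tm.loc n) (Tm.loc n)
  | obj {attrs attrs' : List (L × Option (Tm L))} :
      ParAttrs phi attrs attrs' → Par phi (Tm.obj attrs) (Tm.obj attrs')
  | congDot {t t' : Tm L} (a : L) : Par phi t t' → Par phi (Tm.dot t a) (Tm.dot t' a)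
  | congApp {t t' u u' : Tm L} (a : L) :
      Par phi t t' → Par phi u u' → Par phi (Tm.app t a u) (Tm.app t' a u')
  | dotPar {t : Tm L} {attrs : List (L × Option (Tm L))} {c : L} {tc : Tm L} :
      Par phi t (Tm.obj attrs) → lookupAttr c attrs = some (some tc) →
      Par phi (Tm.dot t c) (subst tc 0 (Tm.obj attrs))
  | dotPhi {t : Tm L} {attrs : List (L × Option (Tm L))} {c : L} :
      Par phi t (Tm.obj attrs) → lookupAttr c attrs = none →
      (lookupAttr phi attrs).isSome →
      Par phi (Tm.dot t c) (Tm.dot (Tm.dot (Tm.obj attrs) phi) c)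
  | appPar {t : Tm L} {attrs : List (L × Option (Tm L))} {c : L} {u u' : Tm L} :
      Par phi t (Tm.obj attrs) → lookupAttr c attrs = some none → Par phi u u' →
      Par phi (Tm.app t c u) (Tm.obj (attachAttr c (incAt 0 u') attrs))

/-- Pointwise parallel reduction on attribute lists: void attributes are kept,
attached attributes reduce in parallel. -/
inductive ParAttrs (phi : L) :
    List (L × Option (Tm L)) → List (L × Option (Tm L)) → Prop where
  | nil : ParAttrs phi [] []
  | void {rest rest' : List (L × Option (Tm L))} (a : L) :
      ParAttrs phi rest rest' → ParAttrs phi ((a, none) :: rest) ((a, none) :: rest')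
  | attached {t t' : Tm L} {rest rest' : List (L × Option (Tm L))} (a : L) :
      Par phi t t' → ParAttrs phi rest rest' →
      ParAttrs phi ((a, some t) :: rest) ((a, some t') :: rest')
end

/-- Head reduction `→h`. -/
inductive Head (phi : L) : Tm L → Tm L → Prop where
  | dotStep {attrs : List (L × Option (Tm L))} {c : L} {tc : Tm L} :
      lookupAttr c attrs = some (some tc) →
      Head phi (dot (obj attrs) c) (subst tc 0 (obj attrs))
  | dotPhi {attrs : List (L × Option (Tm L))} {c : L} :
      lookupAttr c attrs = none → (lookupAttr phi attrs).isSome →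
      Head phi (dot (obj attrs) c) (dot (dot (obj attrs) phi) c)
  | appStep {attrs : List (L × Option (Tm L))} {c : L} {u : Tm L} :
      lookupAttr c attrs = some none →
      Head phi (app (obj attrs) c u) (obj (attachAttr c (incAt 0 u) attrs))
  | congDot {t t' : Tm L} (a : L) : Head phi t t' → Head phi (dot t a) (dot t' a)
  | congApp {t t' u : Tm L} (a : L) : Head phi t t' → Head phi (app t a u) (app t' a u)

/-- Internal parallel reduction `⇛ᵢ`. -/
inductive ParI (phi : L) : Tm L → Tm L → Prop where
  | loc (n : Nat) : ParI phi (Tm.loc n) (Tm.loc n)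
  | obj {attrs attrs' : List (L × Option (Tm L))} :
      ParAttrs phi attrs attrs' → ParI phi (Tm.obj attrs) (Tm.obj attrs')
  | congDot {t t' : Tm L} (a : L) : ParI phi t t' → ParI phi (Tm.dot t a) (Tm.dot t' a)
  | congApp {t t' u u' : Tm L} (a : L) :
      ParI phi t t' → Par phi u u' → ParI phi (Tm.app t a u) (Tm.app t' a u')

/-- Internal (regular) reduction `→ᵢ`. -/
inductive StepI (phi : L) : Tm L → Tm L → Prop where
  | congObj {t t' : Tm L} (pre post : List (L × Option (Tm L))) (b : L) :
      Step phi t t' →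
      StepI phi (obj (pre ++ (b, some t) :: post)) (obj (pre ++ (b, some t') :: post))
  | congDot {t t' : Tm L} (a : L) : StepI phi t t' → StepI phi (dot t a) (dot t' a)
  | congAppL {t t' u : Tm L} (a : L) : StepI phi t t' → StepI phi (app t a u) (app t' a u)
  | congAppR {t u u' : Tm L} (a : L) : Step phi u u' → StepI phi (app t a u) (app t a u')

end Reductions

end Tm

end PhiCalc
namespace PhiCalc
namespace Tm
section Extra
variable {L : Type} [DecidableEq L]

mutual
/-- Complete development `t⁺`. -/
def cd (phi : L) : Tm L → Tm L
  | loc n => loc n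
  | dot t a =>
    match cd phi t with
    | obj attrs =>
      match lookupAttr a attrs with
      | some (some ta) => subst ta 0 (obj attrs)
      | some none => dot (obj attrs) a
      | none =>
        if (lookupAttr phi attrs).isSome then dot (dot (obj attrs) phi) a
        else dot (obj attrs) a
    | t' => dot t' a
  | app t a u =>
    match cd phi t with
    | obj attrs =>
      match lookupAttr a attrs with
      | some none => obj (attachAttr a (incAt 0 (cd phi u)) attrs)
      | _ => app (obj attrs) a (cd phi u)
    | t' => app t' a (cd phi u)
  | obj attrs => obj (cdList phi attrs)

def cdList (phi : L) : List (L × Option (Tm L)) → List (L × Option (Tm L))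
  | [] => []
  | (a, none) :: rest => (a, none) :: cdList phi rest
  | (a, some t) :: rest => (a, some (cd phi t)) :: cdList phi rest
end

/-- Head reduction as a (deterministic) partial function. -/
def headRed (phi : L) : Tm L → Option (Tm L)
  | loc _ => none
  | obj _ => none
  | dot t a =>
    match t with
    | obj attrs =>
      match lookupAttr a attrs with
      | some (some ta) => some (subst ta 0 (obj attrs))
      | some none => none
      | none =>
        if (lookupAttr phi attrs).isSome then some (dot (dot (obj attrs) phi) a)
        else none
    | t => (headRed phi t).map (fun t' => dot t' a)
  | app t a u =>
    match t with
    | obj attrs =>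
      match lookupAttr a attrs with
      | some none => some (obj (attachAttr a (incAt 0 u) attrs))
      | _ => none
    | t => (headRed phi t).map (fun t' => app t' a u)

mutual
/-- Normal order reduction `⇝ℓ` as a (deterministic) partial function:
head reduction first, otherwise reduce the leftmost subterm that reduces. -/
def nordRed (phi : L) : Tm L → Option (Tm L)
  | loc _ => none
  | dot t a =>
    match headRed phi (dot t a) with
    | some s => some s
    | none => (nordRed phi t).map (fun t' => dot t' a)
  | app t a u =>
    match headRed phi (app t a u) with
    | some s => some s
    | none =>
      match nordRed phi t with
      | some t' => some (app t' a u)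
      | none => (nordRed phi u).map (fun u' => app t a u')
  | obj attrs => (nordList phi attrs).map obj

def nordList (phi : L) : List (L × Option (Tm L)) → Option (List (L × Option (Tm L)))
  | [] => none
  | (a, none) :: rest => (nordList phi rest).map (fun rest' => (a, none) :: rest')
  | (a, some t) :: rest =>
    match nordRed phi t with
    | some t' => some ((a, some t') :: rest)
    | none => (nordList phi rest).map (fun rest' => (a, some t) :: rest')
end

/-- Normal order reduction relation. -/
def NOrd (phi : L) (t t' : Tm L) : Prop := nordRed phi t = some t'

end Extra
end Tm
end PhiCalc
namespace PhiCalc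
namespace Tm

/-- Structural induction on terms, with object attributes handled by membership. -/
theorem induction_mem {L : Type} {P : Tm L → Prop}
    (loc : ∀ m, P (loc m)) (dot : ∀ t a, P t → P (dot t a))
    (app : ∀ t a u, P t → P u → P (app t a u))
    (obj : ∀ attrs, (∀ a t, (a, some t) ∈ attrs → P t) → P (obj attrs)) (t : Tm L) : P t :=
  Tm.rec (motive_1 := P) (motive_2 := fun l => ∀ a t, (a, some t) ∈ l → P t)
    (motive_3 := fun p => ∀ t, p.2 = some t → P t) (motive_4 := fun o => ∀ t, o = some t → P t)
    loc (fun t a => dot t a) (fun t a u => app t a u) obj (by simp)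
    (fun p l hp hl a t h => by
      rcases List.mem_cons.1 h with rfl | h
      · exact hp t rfl
      · exact hl a t h)
    (fun _ _ h => h) (by simp) (fun t ht s h => by cases h; exact ht) t

/-- Apply `f` to every attached attribute. -/
def mapAttrs {L : Type} (f : Tm L → Tm L) (l : List (L × Option (Tm L))) :
    List (L × Option (Tm L)) :=
  l.map fun p => (p.1, p.2.map f)

section Calculus

variable {L : Type}

theorem mapAttrs_mapAttrs (f g : Tm L → Tm L) (l : List (L × Option (Tm L))) :
    mapAttrs f (mapAttrs g l) = mapAttrs (fun t => f (g t)) l := by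
  simp [mapAttrs, Function.comp_def]

theorem mapAttrs_congr {f g : Tm L → Tm L} {l : List (L × Option (Tm L))}
    (h : ∀ a t, (a, some t) ∈ l → f t = g t) : mapAttrs f l = mapAttrs g l := by
  refine List.map_congr_left ?_
  rintro ⟨a, _ | t⟩ hp
  · rfl
  · simp [h a t hp]

theorem mapAttrs_eq_self {f : Tm L → Tm L} {l : List (L × Option (Tm L))}
    (h : ∀ a t, (a, some t) ∈ l → f t = t) : mapAttrs f l = l := by
  rw [mapAttrs_congr (g := id) h]
  simp [mapAttrs]

theorem incAtList_eq (n : ℕ) (l : List (L × Option (Tm L))) :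
    incAtList n l = mapAttrs (incAt n) l := by
  induction l with
  | nil => simp [incAtList, mapAttrs]
  | cons p l ih => rcases p with ⟨a, _ | t⟩ <;> simpa [incAtList, mapAttrs] using ih

theorem substList_eq (l : List (L × Option (Tm L))) (n : ℕ) (u : Tm L) :
    substList l n u = mapAttrs (fun t => subst t n u) l := by
  induction l with
  | nil => simp [substList, mapAttrs]
  | cons p l ih => rcases p with ⟨a, _ | t⟩ <;> simpa [substList, mapAttrs] using ih

theorem incAt_obj (n : ℕ) (l : List (L × Option (Tm L))) :
    incAt n (obj l) = obj (mapAttrs (incAt (n + 1)) l) := by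
  rw [incAt, incAtList_eq]

theorem subst_obj (l : List (L × Option (Tm L))) (n : ℕ) (u : Tm L) :
    subst (obj l) n u = obj (mapAttrs (fun t => subst t (n + 1) (incAt 0 u)) l) := by
  rw [subst, substList_eq]

theorem incAt_incAt (t : Tm L) {k n : ℕ} (h : k ≤ n) :
    incAt (n + 1) (incAt k t) = incAt k (incAt n t) := by
  induction t using induction_mem generalizing k n with
  | loc m => simp only [incAt]; split_ifs <;> simp only [incAt] <;> grind
  | dot t a ih => simp only [incAt, ih h]
  | app t a u iht ihu => simp only [incAt, iht h, ihu h]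
  | obj l ih =>
    simp only [incAt_obj, mapAttrs_mapAttrs]
    rw [mapAttrs_congr fun a t ht => ih a t ht (Nat.succ_le_succ h)]

theorem subst_incAt_self (t : Tm L) (n : ℕ) (u : Tm L) : subst (incAt n t) n u = t := by
  induction t using induction_mem generalizing n u with
  | loc m => simp only [incAt]; split_ifs <;> simp only [subst] <;> grind
  | dot t a ih => simp only [incAt, subst, ih]
  | app t a u iht ihu => simp only [incAt, subst, iht, ihu]
  | obj l ih =>
    simp only [incAt_obj, subst_obj, mapAttrs_mapAttrs]
    rw [mapAttrs_eq_self fun a t ht => ih a t ht _ _]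

theorem incAt_subst_of_le (t u : Tm L) {k n : ℕ} (h : k ≤ n) :
    incAt k (subst t n u) = subst (incAt k t) (n + 1) (incAt k u) := by
  induction t using induction_mem generalizing k n u with
  | loc m => simp only [incAt, subst]; split_ifs <;> simp only [incAt, subst] <;> grind
  | dot t a ih => simp only [incAt, subst, ih u h]
  | app t a v iht ihv => simp only [incAt, subst, iht u h, ihv u h]
  | obj l ih =>
    simp only [incAt_obj, subst_obj, mapAttrs_mapAttrs]
    rw [mapAttrs_congr fun a t ht => ih a t ht _ (Nat.succ_le_succ h)]
    simp only [incAt_incAt u (Nat.zero_le k)]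

theorem incAt_subst_of_ge (t u : Tm L) {k n : ℕ} (h : n ≤ k) :
    incAt k (subst t n u) = subst (incAt (k + 1) t) n (incAt k u) := by
  induction t using induction_mem generalizing k n u with
  | loc m => simp only [incAt, subst]; split_ifs <;> simp only [incAt, subst] <;> grind
  | dot t a ih => simp only [incAt, subst, ih u h]
  | app t a v iht ihv => simp only [incAt, subst, iht u h, ihv u h]
  | obj l ih =>
    simp only [incAt_obj, subst_obj, mapAttrs_mapAttrs]
    rw [mapAttrs_congr fun a t ht => ih a t ht _ (Nat.succ_le_succ h)]
    simp only [incAt_incAt u (Nat.zero_le k)]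

theorem subst_subst (t u v : Tm L) {i n : ℕ} (h : i ≤ n) :
    subst (subst t i v) n u = subst (subst t (n + 1) (incAt i u)) i (subst v n u) := by
  induction t using induction_mem generalizing i n u v with
  | loc m =>
    rcases lt_trichotomy m (n + 1) with hm | rfl | hm
    · simp only [subst, hm, if_true]
      split_ifs <;> simp only [subst] <;> grind
    · have h₁ : ¬ n + 1 < i := by omega
      have h₂ : n + 1 ≠ i := by omega
      simp [subst, h₁, h₂, subst_incAt_self]
    · have h₁ : ¬ m < i := by omega
      have h₂ : m ≠ i := by omega
      have h₃ : ¬ m < n + 1 := by omega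
      have h₄ : m ≠ n + 1 := by omega
      simp only [subst, h₁, h₂, h₃, h₄, if_false]
      grind
  | dot t a ih => simp only [subst, ih u v h]
  | app t a w iht ihw => simp only [subst, iht u v h, ihw u v h]
  | obj l ih =>
    simp only [subst_obj, mapAttrs_mapAttrs]
    rw [mapAttrs_congr fun a t ht => ih a t ht _ _ (Nat.succ_le_succ h)]
    simp only [incAt_incAt u (Nat.zero_le i), incAt_subst_of_le v u (Nat.zero_le n)]

variable [DecidableEq L]

theorem lookupAttr_mapAttrs (f : Tm L → Tm L) (c : L) (l : List (L × Option (Tm L))) :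
    lookupAttr c (mapAttrs f l) = (lookupAttr c l).map (Option.map f) := by
  induction l with
  | nil => rfl
  | cons p l ih =>
    simp only [mapAttrs, List.map_cons, lookupAttr] at ih ⊢
    split_ifs
    · rfl
    · exact ih

theorem mapAttrs_attachAttr (f : Tm L → Tm L) (c : L) (u : Tm L)
    (l : List (L × Option (Tm L))) :
    mapAttrs f (attachAttr c u l) = attachAttr c (f u) (mapAttrs f l) := by
  induction l with
  | nil => rfl
  | cons p l ih =>
    simp only [mapAttrs, List.map_cons, attachAttr] at ih ⊢
    split_ifs
    · rfl
    · rw [List.map_cons, ih]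

variable {phi : L}

theorem Par.obj_inv {l : List (L × Option (Tm L))} {t : Tm L} (h : Par phi (Tm.obj l) t) :
    ∃ l', t = Tm.obj l' ∧ ParAttrs phi l l' := by
  cases h with
  | obj h => exact ⟨_, rfl, h⟩

theorem ParAttrs.lookupAttr_rel {l l' : List (L × Option (Tm L))} (h : ParAttrs phi l l')
    (c : L) : Option.Rel (Option.Rel (Par phi)) (lookupAttr c l) (lookupAttr c l') := by
  induction l generalizing l' with
  | nil => cases h; exact .none
  | cons p l ih =>
    cases h with
    | void a h =>
      simp only [lookupAttr]
      split_ifs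
      · exact .some .none
      · exact ih h
    | attached a ht h =>
      simp only [lookupAttr]
      split_ifs
      · exact .some (.some ht)
      · exact ih h

theorem ParAttrs.attachAttr {l l' : List (L × Option (Tm L))} (h : ParAttrs phi l l')
    (c : L) {u u' : Tm L} (hu : Par phi u u') :
    ParAttrs phi (attachAttr c u l) (attachAttr c u' l') := by
  induction l generalizing l' with
  | nil => cases h; exact .nil
  | cons p l ih =>
    cases h with
    | void a h =>
      simp only [Tm.attachAttr]
      split_ifs
      · exact .attached a hu h
      · exact .void a (ih h)
    | attached a ht h =>
      simp only [Tm.attachAttr]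
      split_ifs
      · exact .attached a hu h
      · exact .attached a ht (ih h)

theorem Par.dot_lookup {t : Tm L} {l : List (L × Option (Tm L))} {c : L} {s r : Tm L}
    (h : Par phi t (Tm.obj l)) (hs : lookupAttr c l = some (some s)) (hr : subst s 0 (Tm.obj l) = r) :
    Par phi (dot t c) r :=
  hr ▸ .dotPar h hs

theorem Par.app_void {t : Tm L} {l : List (L × Option (Tm L))} {c : L} {u u' : Tm L}
    {r : List (L × Option (Tm L))} (h : Par phi t (Tm.obj l)) (hs : lookupAttr c l = some none)
    (hu : Par phi u u') (hr : Tm.attachAttr c (incAt 0 u') l = r) :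
    Par phi (app t c u) (Tm.obj r) :=
  hr ▸ .appPar h hs hu

theorem Par.incAt {t t' : Tm L} (h : Par phi t t') (k : ℕ) :
    Par phi (incAt k t) (incAt k t') := by
  refine Par.rec
    (motive_1 := fun t t' _ => ∀ k, Par phi (Tm.incAt k t) (Tm.incAt k t'))
    (motive_2 := fun l l' _ =>
      ∀ k, ParAttrs phi (mapAttrs (Tm.incAt k) l) (mapAttrs (Tm.incAt k) l'))
    ?_ ?_ ?_ ?_ ?_ ?_ ?_ ?_ ?_ ?_ h k
  · intro n k
    simp only [Tm.incAt]
    split_ifs <;> exact .loc _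
  · intro l l' _ ih k
    simpa only [incAt_obj] using Par.obj (ih (k + 1))
  · intro t t' a _ ih k
    simpa only [Tm.incAt] using Par.congDot a (ih k)
  · intro t t' u u' a _ _ iht ihu k
    simpa only [Tm.incAt] using Par.congApp a (iht k) (ihu k)
  · intro t l c s _ hs ih k
    have ih := ih k
    rw [incAt_obj] at ih
    rw [Tm.incAt]
    refine ih.dot_lookup (s := Tm.incAt (k + 1) s) (by simp [lookupAttr_mapAttrs, hs]) ?_
    rw [incAt_subst_of_ge _ _ (Nat.zero_le k), incAt_obj]
  · intro t l c _ hc hphi ih k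
    have ih := ih k
    rw [incAt_obj] at ih
    simp only [Tm.incAt, incAtList_eq]
    exact .dotPhi ih (by simp [lookupAttr_mapAttrs, hc]) (by simpa [lookupAttr_mapAttrs] using hphi)
  · intro t l c u u' _ hc _ iht ihu k
    have iht := iht k
    rw [incAt_obj] at iht
    rw [Tm.incAt, incAt_obj]
    refine iht.app_void (by simp [lookupAttr_mapAttrs, hc]) (ihu k) ?_
    rw [mapAttrs_attachAttr, incAt_incAt _ (Nat.zero_le k)]
  · exact fun _ => .nil
  · exact fun a _ ih k => .void a (ih k)
  · exact fun a _ _ iht ih k => .attached a (iht k) (ih k)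

theorem Par.subst {t t' u u' : Tm L} (h : Par phi t t') (n : ℕ) (hu : Par phi u u') :
    Par phi (subst t n u) (subst t' n u') := by
  refine Par.rec
    (motive_1 := fun t t' _ => ∀ n u u', Par phi u u' →
      Par phi (Tm.subst t n u) (Tm.subst t' n u'))
    (motive_2 := fun l l' _ => ∀ n u u', Par phi u u' →
      ParAttrs phi (mapAttrs (fun t => Tm.subst t n u) l) (mapAttrs (fun t => Tm.subst t n u') l'))
    ?_ ?_ ?_ ?_ ?_ ?_ ?_ ?_ ?_ ?_ h n u u' hu
  · intro m n u u' hu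
    simp only [Tm.subst]
    split_ifs
    exacts [.loc _, hu, .loc _]
  · intro l l' _ ih n u u' hu
    simpa only [subst_obj] using Par.obj (ih (n + 1) _ _ (hu.incAt 0))
  · intro t t' a _ ih n u u' hu
    simpa only [Tm.subst] using Par.congDot a (ih n u u' hu)
  · intro t t' v v' a _ _ iht ihv n u u' hu
    simpa only [Tm.subst] using Par.congApp a (iht n u u' hu) (ihv n u u' hu)
  · intro t l c s _ hs ih n u u' hu
    have ih := ih n u u' hu
    rw [subst_obj] at ih
    rw [Tm.subst]
    refine ih.dot_lookup (s := Tm.subst s (n + 1) (Tm.incAt 0 u'))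
      (by simp [lookupAttr_mapAttrs, hs]) ?_
    rw [subst_subst _ _ _ (Nat.zero_le n), subst_obj]
  · intro t l c _ hc hphi ih n u u' hu
    have ih := ih n u u' hu
    rw [subst_obj] at ih
    simp only [Tm.subst, substList_eq]
    exact .dotPhi ih (by simp [lookupAttr_mapAttrs, hc]) (by simpa [lookupAttr_mapAttrs] using hphi)
  · intro t l c v v' _ hc _ iht ihv n u u' hu
    have iht := iht n u u' hu
    rw [subst_obj] at iht
    rw [Tm.subst, subst_obj]
    refine iht.app_void (by simp [lookupAttr_mapAttrs, hc]) (ihv n u u' hu) ?_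
    rw [mapAttrs_attachAttr, incAt_subst_of_le _ _ (Nat.zero_le n)]
  · exact fun _ _ _ _ => .nil
  · exact fun a _ ih n u u' hu => .void a (ih n u u' hu)
  · exact fun a _ _ iht ih n u u' hu => .attached a (iht n u u' hu) (ih n u u' hu)

theorem Par.dot_cd {t s : Tm L} (h : Par phi s (cd phi t)) (a : L) :
    Par phi (dot s a) (cd phi (dot t a)) := by
  rw [cd]
  split
  · rename_i l hl
    rw [hl] at h
    split
    · exact .dotPar h ‹_›
    · exact .congDot a h
    · split_ifs
      · exact .dotPhi h ‹_› ‹_›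
      · exact .congDot a h
  · exact .congDot a h

theorem Par.app_cd {t s u v : Tm L} (h : Par phi s (cd phi t)) (a : L)
    (hv : Par phi v (cd phi u)) : Par phi (app s a v) (cd phi (app t a u)) := by
  rw [cd]
  split
  · rename_i l hl
    rw [hl] at h
    split
    · exact .appPar h ‹_› hv
    · exact .congApp a h hv
  · exact .congApp a h hv

end Calculus

end Tm
end PhiCalc
open PhiCalc Tm in
/-- Complete development bounds parallel reduction: if `t ⇛ t'` then `t' ⇛ t⁺`. -/
theorem complete_development_bound {L : Type} [DecidableEq L] (phi : L) {t t' : Tm L}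
    (h : Par phi t t') : Par phi t' (cd phi t) := by
  refine Par.rec
    (motive_1 := fun t t' _ => Par phi t' (cd phi t))
    (motive_2 := fun l l' _ => ParAttrs phi l' (cdList phi l))
    ?_ ?_ ?_ ?_ ?_ ?_ ?_ ?_ ?_ ?_ h
  · intro n
    rw [cd]
    exact .loc n
  · intro l l' _ ih
    rw [cd]
    exact .obj ih
  · exact fun a _ ih => ih.dot_cd a
  · exact fun a _ _ iht ihu => iht.app_cd a ihu
  · intro t l c s _ hs ih
    obtain ⟨l', hl', hll'⟩ := ih.obj_inv
    have hrel := hll'.lookupAttr_rel c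
    rw [hs] at hrel
    generalize ho : lookupAttr c l' = o at hrel
    obtain ⟨⟨hss'⟩⟩ := hrel
    simp only [cd, hl', ho]
    exact hss'.subst 0 (.obj hll')
  · intro t l c _ hc hphi ih
    obtain ⟨l', hl', hll'⟩ := ih.obj_inv
    have hrel := hll'.lookupAttr_rel c
    have hrel_phi := hll'.lookupAttr_rel phi
    rw [hc] at hrel
    generalize ho : lookupAttr c l' = o at hrel
    cases hrel
    have hphi' : (lookupAttr phi l').isSome := by
      revert hphi hrel_phi
      generalize lookupAttr phi l = x
      generalize lookupAttr phi l' = y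
      rintro h (_ | _)
      · rfl
      · exact h
    simp only [cd, hl', ho, hphi', if_true]
    exact .congDot c (.congDot phi (.obj hll'))
  · intro t l c u u' _ hc _ iht ihu
    obtain ⟨l', hl', hll'⟩ := iht.obj_inv
    have hrel := hll'.lookupAttr_rel c
    rw [hc] at hrel
    generalize ho : lookupAttr c l' = o at hrel
    obtain ⟨⟨⟩⟩ := hrel
    simp only [cd, hl', ho]
    exact .obj (hll'.attachAttr c (ihu.incAt 0))
  · rw [cdList]
    exact .nil
  · intro l l' a _ ih
    rw [cdList]
    exact .void a ih
  · intro t t' l l' a _ _ iht ih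
    rw [cdList]
    exact .attached a iht ih
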